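/- Let t be a quasi-tree of a grammar G. For every node n of t, the word (α(n))_≪ belongs to L_D; consequently, for the quasi-tree t rooted at a node n, α(t) = ā a (α(n))_≪ and α(t) ∈ L_D. -/

import Mathlib

/-- The two-letter Dyck alphabet: `D.ab` is `ā` (the opening symbol) and `D.a` is `a`
(the closing symbol). -/
inductive D where
  | ab : D  -- ā
  | a : D   -- a
deriving DecidableEq

/-- Parse trees of the grammar `G_D = ({S}, {ā, a}, S, {S → ā S a S, S → ε})`:
`eps` is an application of `S → ε` and `node t₁ t₂` an application of `S → ā S a S`. -/
inductive DyckTree where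
  | eps : DyckTree
  | node : DyckTree → DyckTree → DyckTree

/-- The word generated by a parse tree of `G_D`. -/
def DyckTree.yield : DyckTree → List D
  | .eps => []
  | .node t₁ t₂ => D.ab :: (t₁.yield ++ D.a :: t₂.yield)

/-- The Dyck language `L_D`: the language generated by `G_D`. -/
def LD : Set (List D) := { w | ∃ t : DyckTree, t.yield = w }

/-- `Matches t i j` holds iff positions `i < j` (0-indexed) of the word `t.yield` form a
matching pair: position `i` carries `ā`, position `j` carries `a`, and the two
corresponding leaves have the same parent in the parse tree `t`. -/
inductive Matches : DyckTree → ℕ → ℕ → Prop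
  | head (t₁ t₂ : DyckTree) : Matches (.node t₁ t₂) 0 (t₁.yield.length + 1)
  | left {t₁ : DyckTree} {i j : ℕ} (t₂ : DyckTree) :
      Matches t₁ i j → Matches (.node t₁ t₂) (i + 1) (j + 1)
  | right {t₂ : DyckTree} {i j : ℕ} (t₁ : DyckTree) :
      Matches t₂ i j → Matches (.node t₁ t₂) (t₁.yield.length + 2 + i) (t₁.yield.length + 2 + j)

/-- `DelStep w v`: `v` results from `w ∈ L_D` by deleting (both positions of) one
matching pair of `w`. -/
def DelStep (w v : List D) : Prop :=
  ∃ (t : DyckTree) (i j : ℕ), t.yield = w ∧ Matches t i j ∧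
    v = (w.eraseIdx j).eraseIdx i

/-- The ordering `≼` on Dyck words: `dyckLE v w` (i.e. `v ≼ w`) holds iff `v` results
from `w` by deleting 0 or more matching pairs. -/
def dyckLE (v w : List D) : Prop := Relation.ReflTransGen DelStep w v

/-- The harmonics: `h_0 = ε` and `h_{i+1} = ā h_i a ā h_i a`. -/
def harmonicW : ℕ → List D
  | 0 => []
  | i + 1 => (D.ab :: (harmonicW i ++ [D.a])) ++ (D.ab :: (harmonicW i ++ [D.a]))

/-- `ĥ_i = ā h_i a`. -/
def hatHarmonic (i : ℕ) : List D := D.ab :: (harmonicW i ++ [D.a])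

/-- The rank of a Dyck word `w`: the greatest `q` such that `h_q ≼ w`. -/
noncomputable def rank (w : List D) : ℕ := sSup { q : ℕ | dyckLE (harmonicW q) w }

/-- Finitely-branching labelled ordered trees (used to represent quasi-trees). -/
inductive RTree (L : Type) where
  | node : L → List (RTree L) → RTree L

/-- The label of the root of a tree. -/
def RTree.label {L : Type} : RTree L → L
  | .node l _ => l

/-- The list of children of the root of a tree. -/
def RTree.children {L : Type} : RTree L → List (RTree L)
  | .node _ ts => ts

/-- The footprint `α(n)` of a node `n` (identified with the subtree rooted at `n`):
`α(n) = a` if `n` is a leaf and `α(n) = a ā^k α(n₁) … α(n_k)` if `n` has the `k ≥ 1`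
children `n₁, …, n_k` (in that order). -/
def alphaN {L : Type} : RTree L → List D
  | .node _ ts =>
      D.a :: (List.replicate ts.length D.ab ++ (ts.attach.map (fun t => alphaN t.1)).flatten)
decreasing_by
  simp only [RTree.node.sizeOf_spec]
  have := List.sizeOf_lt_of_mem t.2
  omega

/-- The footprint `α(t)` of a tree `t` with root `n`: `α(t) = ā α(n)`. -/
def alphaT {L : Type} (t : RTree L) : List D := D.ab :: alphaN t

/-- `IsSubtree s t`: `s` is the subtree of `t` rooted at some node of `t`. -/
inductive IsSubtree {L : Type} : RTree L → RTree L → Prop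
  | refl (t : RTree L) : IsSubtree t t
  | child {s c : RTree L} (t : RTree L) : c ∈ t.children → IsSubtree s c → IsSubtree s t

/-- Labels of quasi-trees of a grammar with variables `N` and terminals `T`:
`none` stands for `ε`, `some (.inl X)` for a variable `X`, `some (.inr b)` for a
terminal `b`. -/
abbrev QLbl (N T : Type) := Option (N ⊕ T)

/-- `IsQuasiTree R t`: `t` is a quasi-tree of the grammar whose rules are `R`
(a rule `(X, w) ∈ R` stands for `X → w`): the root is labelled by some
`Z ∈ V ∪ Σ ∪ {ε}`, interior nodes are labelled by variables, leaves by terminals or by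
`ε` (an `ε`-leaf being the only child of its parent), and an interior node labelled `X`
with children labelled `X₁, …, X_k` (in order) corresponds to a rule `X → X₁ … X_k`
(a rule `X → ε` corresponding to an interior node `X` whose only child is an `ε`-leaf). -/
inductive IsQuasiTree {N T : Type} (R : Set (N × List (N ⊕ T))) :
    RTree (QLbl N T) → Prop
  | leafT (b : T) : IsQuasiTree R (.node (some (.inr b)) [])
  | leafE : IsQuasiTree R (.node none [])
  | nodeE {X : N} (h : (X, ([] : List (N ⊕ T))) ∈ R) :
      IsQuasiTree R (.node (some (.inl X)) [.node none []])
  | nodeR {X : N} {ts : List (RTree (QLbl N T))} {w : List (N ⊕ T)}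
      (hne : ts ≠ []) (hrule : (X, w) ∈ R) (hlab : ts.map RTree.label = w.map some)
      (hch : ∀ t ∈ ts, IsQuasiTree R t) :
      IsQuasiTree R (.node (some (.inl X)) ts)

theorem nil_mem_LD : [] ∈ LD := ⟨.eps, rfl⟩

theorem cons_append_cons_mem_LD {u v : List D} (hu : u ∈ LD) (hv : v ∈ LD) :
    D.ab :: (u ++ D.a :: v) ∈ LD := by
  obtain ⟨t₁, rfl⟩ := hu
  obtain ⟨t₂, rfl⟩ := hv
  exact ⟨.node t₁ t₂, rfl⟩

/-- If `u, v₁, …, v_k ∈ L_D` then `ā^k u a v₁ … a v_k ∈ L_D`. -/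
theorem replicate_append_flatten_mem_LD (ws : List (List D))
    (hws : ∀ w ∈ ws, ∃ v ∈ LD, w = D.a :: v) {u : List D} (hu : u ∈ LD) :
    List.replicate ws.length D.ab ++ (u ++ ws.flatten) ∈ LD := by
  induction ws generalizing u with
  | nil => simpa using hu
  | cons w ws ih =>
    obtain ⟨v, hv, rfl⟩ := hws w (by simp)
    have h := ih (fun w hw => hws w (by simp [hw])) (cons_append_cons_mem_LD hu hv)
    simpa [List.replicate_succ'] using h

theorem alphaN_node {L : Type} (l : L) (ts : List (RTree L)) :
    alphaN (.node l ts) =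
      D.a :: (List.replicate ts.length D.ab ++ (ts.map alphaN).flatten) := by
  rw [alphaN, List.attach_map_val]

theorem alphaN_eq_cons_tail {L : Type} (t : RTree L) : alphaN t = D.a :: (alphaN t).tail := by
  cases t
  rw [alphaN_node, List.tail_cons]

/-- The footprint of any node of a finitely branching tree is a Dyck word after its first
symbol is removed. -/
theorem tail_alphaN_mem_LD {L : Type} : ∀ t : RTree L, (alphaN t).tail ∈ LD
  | .node l ts => by
    have h := replicate_append_flatten_mem_LD (ts.map alphaN)
      (fun w hw => by
        obtain ⟨s, hs, rfl⟩ := List.mem_map.mp hw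
        exact ⟨_, tail_alphaN_mem_LD s, alphaN_eq_cons_tail s⟩) nil_mem_LD
    simpa [alphaN_node] using h
decreasing_by
  have := List.sizeOf_lt_of_mem hs
  simp only [RTree.node.sizeOf_spec]
  omega

/-!
STATEMENT 3: Let `t` be a quasi-tree of a grammar `G`. For every node `n` of `t`, the
word `(α(n))_≪` belongs to `L_D`; consequently, for the quasi-tree `t` rooted at a node
`n`, `α(t) = ā a (α(n))_≪` and `α(t) ∈ L_D`.

(Nodes of `t` are identified with the subtrees of `t` they root, and `w_≪ = w.tail`
denotes `w` with its first symbol removed.)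
-/

theorem footprint_mem_LD {N T : Type} (R : Set (N × List (N ⊕ T)))
    (t : RTree (QLbl N T)) (ht : IsQuasiTree R t) :
    (∀ s : RTree (QLbl N T), IsSubtree s t → (alphaN s).tail ∈ LD) ∧
    alphaT t = D.ab :: D.a :: (alphaN t).tail ∧ alphaT t ∈ LD := by
  have h : alphaT t = D.ab :: D.a :: (alphaN t).tail :=
    congrArg (List.cons D.ab) (alphaN_eq_cons_tail t)
  refine ⟨fun s _ => tail_alphaN_mem_LD s, h, ?_⟩
  rw [h]
  exact cons_append_cons_mem_LD nil_mem_LD (tail_alphaN_mem_LD t)
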